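/- Let p be an odd prime, k a nonzero integer, α = ord_p(k) the exact power of p dividing k, and β a positive integer. Then G_k(p^β) = 0 if β ≤ α is odd; G_k(p^β) = φ(p^β) if β ≤ α is even; G_k(p^β) = −p^α if β = α+1 is even; G_k(p^β) = (k p^{-α} / p) p^α √p if β = α+1 is odd; and G_k(p^β) = 0 if β ≥ α+2. -/

import Mathlib

open Finset

/-- The Gauss-type sum
`G_k(n) = ((1-i)/2 + (−1/n)(1+i)/2) ∑_{a mod n} (a/n) e(ak/n)` for odd `n`. -/
noncomputable def Gk (k : ℤ) (n : ℕ) : ℂ :=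
  ((1 - Complex.I) / 2 + (jacobiSym (-1) n : ℂ) * (1 + Complex.I) / 2) *
    ∑ a ∈ Finset.range n,
      (jacobiSym (a : ℤ) n : ℂ) * Complex.exp (2 * Real.pi * Complex.I * a * k / n)

lemma prod_diff_sq {m : ℕ} {z : ℂ} (hz : IsPrimitiveRoot z (2*m+1)) :
    (∏ j ∈ range m, (z^(j+1) - z^(2*m+1-(j+1))))^2 = (-1)^m * ((2*m+1 : ℕ) : ℂ) := by
  have hμ : IsPrimitiveRoot (z^2) (2*m+1) := by
    apply hz.pow_of_coprime
    simp
  have h := hμ.prod_one_sub_pow_eq_order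
  have h0 : z ≠ 0 := hz.ne_zero (by omega)
  rw [two_mul m, Finset.prod_range_add, ← Finset.prod_range_reflect (fun x => 1 - (z^2)^(m+x+1)),
    ← Finset.prod_mul_distrib] at h
  push_cast at h ⊢
  rw [show (2*(m:ℂ)+1) = m + m + 1 by ring, ← h, ← Finset.prod_pow]
  conv_rhs => rw [← Finset.card_range m, ← Finset.prod_const, Finset.card_range,
    ← Finset.prod_mul_distrib]
  apply Finset.prod_congr rfl
  intro j hj
  have hj := Finset.mem_range.1 hj
  obtain ⟨t, rfl⟩ : ∃ t, m = j + 1 + t := ⟨m - j - 1, by omega⟩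
  have e1 : 2 * (j+1+t) - j = j + 2 + 2 * t := by omega
  have e2 : j + 1 + t + (j + 1 + t - 1 - j) + 1 = j + 2 + 2 * t := by omega
  rw [e1, e2]
  have hp : z^(j+1) * z^(j+2+2*t) = 1 := by
    rw [← pow_add, ← hz.pow_eq_one]; congr 1; ring
  rw [pow_right_comm z 2 (j+1), pow_right_comm z 2 (j+2+2*t)]
  generalize z^(j+1) = a at *
  generalize z^(j+2+2*t) = b at *
  linear_combination (a*b - 1) * hp

lemma prod_diff_eq (m : ℕ) :
    ∏ j ∈ range m, (Complex.exp (2 * Real.pi * Complex.I / (2*m+1 : ℕ))^(j+1)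
        - Complex.exp (2 * Real.pi * Complex.I / (2*m+1 : ℕ))^(2*m+1-(j+1)))
      = Complex.I^m * (Real.sqrt (2*m+1 : ℕ) : ℂ) := by
  have hz := Complex.isPrimitiveRoot_exp (2*m+1) (by omega)
  have hsq := prod_diff_sq hz
  set z := Complex.exp (2 * Real.pi * Complex.I / (2*m+1 : ℕ)) with hzdef
  have key : ∏ j ∈ range m, (z^(j+1) - z^(2*m+1-(j+1)))
      = Complex.I^m * ((∏ j ∈ range m, 2 * Real.sin (2 * Real.pi * (j+1) / (2*m+1)) : ℝ) : ℂ) := by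
    push_cast
    conv_rhs => rw [← Finset.card_range m, ← Finset.prod_const, Finset.card_range,
      ← Finset.prod_mul_distrib]
    apply Finset.prod_congr rfl
    intro j hj
    have hj := Finset.mem_range.1 hj
    have h1 : z^(2*m+1-(j+1)) = (z^(j+1))⁻¹ := by
      apply eq_inv_of_mul_eq_one_left
      rw [← pow_add, ← hz.pow_eq_one]; congr 1; omega
    have hne : (2*(m:ℂ)+1) ≠ 0 := by exact_mod_cast (by omega : 2*m+1 ≠ 0)
    have h2 : z^(j+1) = Complex.exp ((2 * Real.pi * (j+1) / (2*m+1)) * Complex.I) := by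
      rw [hzdef, ← Complex.exp_nat_mul]; congr 1; push_cast; field_simp
    simp only [Nat.add_sub_add_right] at h1 ⊢
    rw [h1, h2, ← Complex.exp_neg, Complex.sin]
    have := Complex.I_sq
    rw [← neg_mul]
    linear_combination (- Complex.exp (-(2 * ↑Real.pi * (↑j + 1) / (2 * ↑m + 1)) * Complex.I)+ Complex.exp ((2 * ↑Real.pi * (↑j + 1) / (2 * ↑m + 1)) * Complex.I)) * this
  have hpos : 0 < ∏ j ∈ range m, 2 * Real.sin (2 * Real.pi * (j+1) / (2*m+1)) := by
    apply Finset.prod_pos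
    intro j hj
    have hj := Finset.mem_range.1 hj
    have hjr : (j:ℝ) + 1 ≤ m := by exact_mod_cast hj
    have := Real.pi_pos
    apply mul_pos two_pos
    apply Real.sin_pos_of_pos_of_lt_pi
    · positivity
    · rw [div_lt_iff₀ (by positivity)]
      nlinarith
  rw [key]
  rw [key, mul_pow, ← pow_mul, mul_comm m 2, pow_mul, Complex.I_sq] at hsq
  have := mul_left_cancel₀ (pow_ne_zero m (by norm_num)) hsq
  congr 2
  symm
  rw [Real.sqrt_eq_iff_mul_self_eq (by positivity) hpos.le]
  rw [← sq]
  exact_mod_cast this.symm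

open Polynomial in
lemma sum_poly (p : ℕ) [Fact p.Prime] (m : ℕ) (hpm : p = 2*m+1) (P : (ZMod p)[X])
    (hP : P.Monic) (hd : P.natDegree = m) :
    ∑ x : ZMod p, x^m * P.eval x = -1 := by
  have hcard : Fintype.card (ZMod p) = p := ZMod.card p
  have hm : 0 < m := by
    have := (Fact.out : p.Prime).two_le
    omega
  simp_rw [Polynomial.eval_eq_sum_range, hd, Finset.mul_sum]
  rw [Finset.sum_comm, Finset.sum_range_succ]
  have h1 : ∑ i ∈ range m, ∑ x : ZMod p, x^m * (P.coeff i * x^i) = 0 := by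
    apply Finset.sum_eq_zero
    intro i hi
    have hi := Finset.mem_range.1 hi
    have := FiniteField.sum_pow_lt_card_sub_one (ZMod p) (m+i) (by rw [hcard]; omega)
    calc _ = P.coeff i * ∑ x : ZMod p, x^(m+i) := by
          rw [Finset.mul_sum]; refine Finset.sum_congr rfl fun x _ => by ring
      _ = 0 := by rw [this, mul_zero]
  have hc : P.coeff m = 1 := by rw [← hd]; exact hP
  rw [h1, hc, zero_add]
  have h2 : ∀ x : ZMod p, x^m * (1 * x^m) = if x = 0 then 0 else 1 := by
    intro x
    split_ifs with h
    · subst h; rw [zero_pow hm.ne']; simp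
    · have := ZMod.pow_card_sub_one_eq_one h
      rw [one_mul, ← pow_add, ← this]; congr 1; omega
  simp_rw [h2]
  rw [Finset.sum_ite]
  simp [Finset.filter_ne', hcard]
  rw [Nat.cast_sub (by omega)]; simp

open Polynomial in
lemma coeff_gauss (p : ℕ) [Fact p.Prime] (m : ℕ) (hpm : p = 2*m+1) :
    (m.factorial : ZMod p) * (∑ j ∈ range p, C ((j:ZMod p)^m) * (X+1)^j : (ZMod p)[X]).coeff m = -1 := by
  rw [← sum_poly p m hpm (descPochhammer (ZMod p) m) (monic_descPochhammer _ m) (descPochhammer_natDegree ..)]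
  rw [Polynomial.finsetSum_coeff, Finset.mul_sum]
  have hb : ∀ f : ZMod p → ZMod p, ∑ x, f x = ∑ j ∈ range p, f (j : ZMod p) := by
    intro f
    symm
    apply Finset.sum_bij (fun (j:ℕ) _ => (j : ZMod p))
    · simp
    · intro a ha b hb hab
      rw [ZMod.natCast_eq_natCast_iff'] at hab
      rwa [Nat.mod_eq_of_lt (mem_range.1 ha), Nat.mod_eq_of_lt (mem_range.1 hb)] at hab
    · intro b _
      exact ⟨b.val, mem_range.2 (ZMod.val_lt b), by simp⟩
    · simp
  rw [hb]
  apply Finset.sum_congr rfl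
  intro j _
  rw [coeff_C_mul, coeff_X_add_one_pow, descPochhammer_eval_eq_descFactorial,
    Nat.descFactorial_eq_factorial_mul_choose]
  push_cast; ring

open Polynomial in
lemma coeff_prod (R : Type*) [CommRing R] (p m : ℕ) (hpm : p = 2*m+1) (hp : (p:R) = 0) :
    (∏ j ∈ range m, ((X+1)^(j+1) - (X+1)^(p-(j+1))) : R[X]).coeff m = 2^m * m.factorial := by
  have h : ∀ j ∈ range m, ∃ Q : R[X], ((X+1)^(j+1) - (X+1)^(p-(j+1))) = X * Q ∧ Q.coeff 0 = 2 * (j+1 : ℕ) := by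
    intro j hj
    have hj := mem_range.1 hj
    have hd : X ∣ ((X+1)^(j+1) - (X+1)^(p-(j+1)) : R[X]) := by
      rw [X_dvd_iff, coeff_sub, coeff_X_add_one_pow, coeff_X_add_one_pow]; simp
    obtain ⟨Q, hQ⟩ := hd
    refine ⟨Q, hQ, ?_⟩
    have := congrArg (fun P => coeff P 1) hQ
    simp only [coeff_sub, coeff_X_add_one_pow, coeff_X_mul, Nat.choose_one_right] at this
    rw [← this, Nat.cast_sub (by omega), hp]; ring
  choose! Q hQ hQ0 using h
  rw [Finset.prod_congr rfl hQ, Finset.prod_mul_distrib, Finset.prod_const, Finset.card_range]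
  have := Polynomial.coeff_X_pow_mul (∏ j ∈ range m, Q j) m 0
  rw [zero_add] at this
  rw [this, Polynomial.coeff_zero_prod, Finset.prod_congr rfl hQ0, Finset.prod_mul_distrib,
    Finset.prod_const, Finset.card_range, ← Nat.cast_prod, Finset.prod_range_add_one_eq_factorial]

lemma fact_sq (p : ℕ) [Fact p.Prime] (m : ℕ) (hpm : p = 2*m+1) :
    (-1)^m * (m.factorial : ZMod p)^2 = -1 := by
  suffices h : (-1)^m * (m.factorial : ZMod p)^2 = ((p-1).factorial : ZMod p) by
    rw [h, ZMod.wilsons_lemma]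
  have e : p - 1 = m + m := by omega
  rw [e, ← Finset.prod_range_add_one_eq_factorial (m+m), Finset.prod_range_add,
    ← Finset.prod_range_reflect (fun x => m + x + 1), sq, Nat.cast_mul, mul_left_comm ((-1)^m : ZMod p),
    Finset.prod_range_add_one_eq_factorial]
  congr 1
  rw [← Finset.prod_range_add_one_eq_factorial]
  push_cast
  conv_lhs => rw [← Finset.card_range m, ← Finset.prod_const, Finset.card_range,
      ← Finset.prod_mul_distrib]
  apply Finset.prod_congr rfl
  intro j hj
  have hj := mem_range.1 hj
  have : (p : ZMod p) = 0 := by simp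
  have h2 : ((m + (m - 1 - j) + 1 + (j+1) : ℕ) : ZMod p) = 0 := by
    rw [← this]; congr 1; omega
  push_cast at h2
  linear_combination -h2

open Polynomial in
lemma eps_eq (p : ℕ) [Fact p.Prime] (m : ℕ) (hpm : p = 2*m+1) (ε : ℤ)
    (h : ∑ j ∈ range p, (legendreSym p j : ℂ) * Complex.exp (2 * Real.pi * Complex.I / p)^j =
      ε * ∏ j ∈ range m, (Complex.exp (2 * Real.pi * Complex.I / p)^(j+1)
        - Complex.exp (2 * Real.pi * Complex.I / p)^(p-(j+1)))) :
    (ε : ZMod p) * 2^m = (-1)^m := by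
  have hpr := (Fact.out : p.Prime)
  have hz := Complex.isPrimitiveRoot_exp p hpr.ne_zero
  set z := Complex.exp (2 * Real.pi * Complex.I / p)
  set F : ℤ[X] := ∑ j ∈ range p, C (legendreSym p j) * X^j -
    C ε * ∏ j ∈ range m, (X^(j+1) - X^(p-(j+1))) with hF
  have h0 : aeval z F = 0 := by
    simp only [hF, map_sub, map_sum, map_mul, map_prod, map_pow, aeval_X, aeval_C]
    simpa [sub_eq_zero] using h
  have hdvd : cyclotomic p ℤ ∣ F := by
    rw [cyclotomic_eq_minpoly hz hpr.pos]
    exact minpoly.isIntegrallyClosed_dvd (hz.isIntegral hpr.pos) h0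
  have hdvd2 : (X - 1 : (ZMod p)[X])^(p-1) ∣ F.map (Int.castRingHom (ZMod p)) := by
    have := Polynomial.map_dvd (Int.castRingHom (ZMod p)) hdvd
    rw [map_cyclotomic] at this
    have h3 := cyclotomic_mul_prime_eq_pow_of_not_dvd (ZMod p) (p := p) (n := 1)
      (by simpa using hpr.one_lt.ne')
    rw [one_mul, cyclotomic_one] at h3
    rwa [h3] at this
  obtain ⟨H, hH⟩ := hdvd2
  have h4 := congrArg (fun P => (P.comp (X+1)).coeff m) hH
  have hl : ∀ j : ℕ, ((legendreSym p j : ℤ) : ZMod p) = (j : ZMod p)^m := by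
    intro j
    rw [legendreSym.eq_pow, show p/2 = m by omega]; simp
  simp only [hF, Polynomial.map_sub, Polynomial.map_sum, Polynomial.map_mul, Polynomial.map_prod,
    Polynomial.map_pow, map_X, Polynomial.map_C, Int.coe_castRingHom, hl, sub_comp, mul_comp, Polynomial.sum_comp, Polynomial.prod_comp,
    pow_comp, X_comp, C_comp, one_comp, add_sub_cancel_right] at h4
  rw [coeff_sub, coeff_C_mul, coeff_prod (ZMod p) p m hpm (by simp), mul_comm (X^(p-1)),
    coeff_mul_X_pow', if_neg (by have := hpr.two_le; omega), sub_eq_zero] at h4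
  have h5 := coeff_gauss p m hpm
  rw [h4] at h5
  have h6 := fact_sq p m hpm
  have h7 : ((-1)^m * (-1)^m : ZMod p) = 1 := by rw [← mul_pow]; simp
  have hne : (m.factorial : ZMod p)^2 ≠ 0 := by
    intro h; rw [h] at h6; simp at h6
  apply mul_right_cancel₀ hne
  linear_combination h5 - h6

lemma sum_zmod (p : ℕ) [Fact p.Prime] (f : ZMod p → ℂ) :
    ∑ x, f x = ∑ j ∈ range p, f (j : ZMod p) := by
  symm
  apply Finset.sum_bij (fun (j:ℕ) _ => (j : ZMod p))
  · simp
  · intro a ha b hb hab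
    rw [ZMod.natCast_eq_natCast_iff'] at hab
    rwa [Nat.mod_eq_of_lt (mem_range.1 ha), Nat.mod_eq_of_lt (mem_range.1 hb)] at hab
  · intro b _
    exact ⟨b.val, mem_range.2 (ZMod.val_lt b), by simp⟩
  · simp

/-- The complex-valued quadratic character. -/
noncomputable def qc (p : ℕ) [Fact p.Prime] : MulChar (ZMod p) ℂ :=
  (quadraticChar (ZMod p)).ringHomComp (Int.castRingHom ℂ)

lemma qc_int (p : ℕ) [Fact p.Prime] (a : ℤ) : qc p a = (legendreSym p a : ℂ) := by
  simp [qc, legendreSym]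

lemma qc_nat (p : ℕ) [Fact p.Prime] (a : ℕ) : qc p a = (legendreSym p a : ℂ) := by
  simp [qc, legendreSym]

lemma qc_quad (p : ℕ) [Fact p.Prime] : (qc p).IsQuadratic :=
  (quadraticChar_isQuadratic (ZMod p)).comp _

lemma qc_ne (p : ℕ) [Fact p.Prime] (hodd : Odd p) : qc p ≠ 1 := by
  rw [qc, MulChar.ringHomComp_ne_one_iff (RingHom.injective_int _)]
  apply quadraticChar_ne_one
  rw [ZMod.ringChar_zmod_n]
  rintro rfl
  exact absurd hodd (by decide)

lemma gauss_eq (p : ℕ) [Fact p.Prime] (χ : MulChar (ZMod p) ℂ) (c : ℤ) :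
    gaussSum χ (ZMod.stdAddChar.mulShift (c : ZMod p)) =
      ∑ j ∈ range p, χ (j : ZMod p) * Complex.exp (2 * Real.pi * Complex.I * j * c / p) := by
  rw [gaussSum, sum_zmod]
  apply Finset.sum_congr rfl
  intro j _
  rw [AddChar.mulShift_apply]
  have := ZMod.stdAddChar_coe (N := p) (c * j)
  push_cast at this
  rw [this]
  congr 3
  ring

lemma gauss_eq_one (p : ℕ) [Fact p.Prime] (χ : MulChar (ZMod p) ℂ) :
    gaussSum χ ZMod.stdAddChar =
      ∑ j ∈ range p, χ (j : ZMod p) * Complex.exp (2 * Real.pi * Complex.I / p)^j := by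
  have := gauss_eq p χ 1
  rw [Int.cast_one, AddChar.mulShift_one] at this
  rw [this]
  apply Finset.sum_congr rfl
  intro j _
  rw [← Complex.exp_nat_mul]
  congr 2
  push_cast; ring

lemma gauss_sum_sign (p : ℕ) [Fact p.Prime] (hodd : Odd p) :
    ((1 - Complex.I) / 2 + (legendreSym p (-1) : ℂ) * (1 + Complex.I) / 2) *
    gaussSum (qc p) ZMod.stdAddChar = Real.sqrt p := by
  have hsq := gaussSum_sq (qc_ne p hodd) (qc_quad p) (ZMod.isPrimitive_stdAddChar p)
  obtain ⟨m, hm⟩ := hodd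
  have hp2 : p ≠ 2 := by omega
  haveI : Fact (2 < p) := ⟨by have := (Fact.out : p.Prime).two_le; omega⟩
  have h1 : qc p (-1) = (-1)^m := by
    have := qc_int p (-1)
    push_cast at this
    rw [this, legendreSym.at_neg_one hp2, ZMod.χ₄_eq_neg_one_pow (by omega), show p/2 = m by omega]
    simp
  rw [h1, ZMod.card] at hsq
  have hz := Complex.isPrimitiveRoot_exp (2*m+1) (by omega)
  have hD := prod_diff_sq hz
  have hE := prod_diff_eq m
  rw [← hm] at hD hE
  rw [← hD, sq_eq_sq_iff_eq_or_eq_neg] at hsq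
  have h2 : (2 : ZMod p)^m = ((ZMod.χ₈ p : ℤ) : ZMod p) := by
    rw [← legendreSym.at_two hp2, legendreSym.eq_pow, show p/2 = m by omega]; simp
  have hε : ∃ ε : ℤ, (ε = 1 ∨ ε = -1) ∧ gaussSum (qc p) ZMod.stdAddChar = ε * (Complex.I^m * Real.sqrt p) ∧
      (ε : ZMod p) * 2^m = (-1)^m := by
    have aux : ∀ ε : ℤ, gaussSum (qc p) ZMod.stdAddChar = ε * ∏ j ∈ range m,
        (Complex.exp (2 * Real.pi * Complex.I / p)^(j+1)
        - Complex.exp (2 * Real.pi * Complex.I / p)^(p-(j+1))) →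
        gaussSum (qc p) ZMod.stdAddChar = ε * (Complex.I^m * Real.sqrt p) ∧
      (ε : ZMod p) * 2^m = (-1)^m := by
      intro ε h
      refine ⟨by rw [h, hE], eps_eq p m hm ε ?_⟩
      rw [← h, gauss_eq_one]
      simp only [qc_nat]
    rcases hsq with h | h
    · exact ⟨1, Or.inl rfl, aux 1 (by rw [h]; simp)⟩
    · exact ⟨-1, Or.inr rfl, aux (-1) (by rw [h]; simp)⟩
  obtain ⟨ε, hε1, hg, he⟩ := hε
  have h3 : (legendreSym p (-1) : ℂ) = (-1)^m := by
    rw [← h1, ← qc_int]; simp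
  have hn : (-1 : ZMod p) ≠ 1 := ZMod.neg_one_ne_one
  rw [hg, h3]
  rw [h2, ZMod.χ₈_nat_eq_if_mod_eight] at he
  have hI := Complex.I_sq
  obtain ⟨t, ht | ht | ht | ht⟩ : ∃ t, m = 4*t ∨ m = 4*t+1 ∨ m = 4*t+2 ∨ m = 4*t+3 :=
    ⟨m/4, by omega⟩
  all_goals
    have hI4 : Complex.I^(4*t) = 1 := by rw [pow_mul, Complex.I_pow_four, one_pow]
    have hn4 : (-1:ZMod p)^(4*t) = 1 := Even.neg_one_pow ⟨2*t, by ring⟩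
    have hn4' : (-1:ℂ)^(4*t) = 1 := Even.neg_one_pow ⟨2*t, by ring⟩
  · rw [if_neg (by omega), if_pos (by omega)] at he
    rcases hε1 with rfl | rfl
    · rw [ht, hI4, hn4']; push_cast; ring
    · rw [ht, hn4] at he; push_cast at he; exact absurd (by linear_combination he) hn
  · rw [if_neg (by omega), if_neg (by omega)] at he
    rcases hε1 with rfl | rfl
    · rw [ht, pow_add, pow_add, hI4, hn4']; push_cast; linear_combination (-Real.sqrt p : ℂ) * hI
    · rw [ht, pow_add, hn4] at he; push_cast at he; exact absurd (by linear_combination -he) hn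
  · rw [if_neg (by omega), if_neg (by omega)] at he
    rcases hε1 with rfl | rfl
    · rw [ht, pow_add, hn4] at he; push_cast at he; exact absurd (by linear_combination he) hn
    · rw [ht, pow_add, pow_add, hI4, hn4']; push_cast; linear_combination (-Real.sqrt p : ℂ) * hI
  · rw [if_neg (by omega), if_pos (by omega)] at he
    rcases hε1 with rfl | rfl
    · rw [ht, pow_add, hn4] at he; push_cast at he; exact absurd (by linear_combination -he) hn
    · rw [ht, pow_add, pow_add, hI4, hn4']; push_cast
      linear_combination (Real.sqrt p : ℂ) * (Complex.I^2-1) * hI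

lemma sum_range_mul_aux (p q : ℕ) (f : ℕ → ℂ) :
    ∑ a ∈ range (p * q), f a = ∑ s ∈ range q, ∑ r ∈ range p, f (p * s + r) := by
  induction q with
  | zero => simp
  | succ q ih => rw [mul_add, mul_one, Finset.sum_range_add, ih, Finset.sum_range_succ]

lemma geom_aux (q : ℕ) (hq : q ≠ 0) (k : ℤ) :
    ∑ s ∈ range q, Complex.exp (2 * Real.pi * Complex.I * k / q)^s = if (q:ℤ) ∣ k then (q:ℂ) else 0 := by
  have hq' : (q:ℂ) ≠ 0 := by exact_mod_cast hq
  have hπ := Complex.two_pi_I_ne_zero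
  split_ifs with h
  · obtain ⟨c, rfl⟩ := h
    have : Complex.exp (2 * Real.pi * Complex.I * ((q * c : ℤ) : ℂ) / q) = 1 := by
      rw [Complex.exp_eq_one_iff]
      exact ⟨c, by push_cast; field_simp⟩
    rw [this]; simp
  · have h1 : Complex.exp (2 * Real.pi * Complex.I * k / q) ≠ 1 := by
      intro h1
      rw [Complex.exp_eq_one_iff] at h1
      obtain ⟨n, hn⟩ := h1
      apply h
      refine ⟨n, ?_⟩
      rw [div_eq_iff hq'] at hn
      have : (k:ℂ) = q * n := mul_left_cancel₀ hπ (by linear_combination hn)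
      exact_mod_cast this
    rw [geom_sum_eq h1, ← Complex.exp_nat_mul]
    have : Complex.exp (q * (2 * Real.pi * Complex.I * k / q)) = 1 := by
      rw [Complex.exp_eq_one_iff]
      exact ⟨k, by field_simp⟩
    rw [this]; simp

lemma sum_main (p : ℕ) [Fact p.Prime] (k : ℤ) (b : ℕ) :
    ∑ a ∈ range (p^(b+1)),
      (jacobiSym (a : ℤ) (p^(b+1)) : ℂ) * Complex.exp (2 * Real.pi * Complex.I * a * k / (p^(b+1) : ℕ))
    = (if ((p:ℤ)^b ∣ k) then (p:ℂ)^b else 0) * ∑ r ∈ range p, (legendreSym p r : ℂ)^(b+1) *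
        Complex.exp (2 * Real.pi * Complex.I * r * k / (p^(b+1) : ℕ)) := by
  have hp0 : p ≠ 0 := (Fact.out : p.Prime).ne_zero
  have hpc : (p:ℂ) ≠ 0 := by exact_mod_cast hp0
  have hg := geom_aux (p^b) (pow_ne_zero _ hp0) k
  push_cast at hg
  rw [← hg, pow_succ' p b, sum_range_mul_aux, Finset.sum_mul_sum, ← pow_succ' p b]
  apply Finset.sum_congr rfl
  intro s _
  apply Finset.sum_congr rfl
  intro r _
  have hJ : jacobiSym ((p * s + r : ℕ) : ℤ) (p^(b+1)) = (legendreSym p r)^(b+1) := by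
    rw [jacobiSym.pow_right, ← jacobiSym.legendreSym.to_jacobiSym]
    congr 1
    simp [legendreSym]
  rw [hJ, ← Complex.exp_nat_mul, mul_left_comm, ← Complex.exp_add]
  push_cast
  congr 2
  field_simp
  ring

lemma sum_main2 (p : ℕ) [Fact p.Prime] (c : ℤ) (b : ℕ) :
    ∑ a ∈ range (p^(b+1)),
      (jacobiSym (a : ℤ) (p^(b+1)) : ℂ) *
        Complex.exp (2 * Real.pi * Complex.I * a * ((p^b * c : ℤ) : ℂ) / (p^(b+1) : ℕ))
    = (p:ℂ)^b * gaussSum ((qc p)^(b+1)) (ZMod.stdAddChar.mulShift (c : ZMod p)) := by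
  have hp0 : p ≠ 0 := (Fact.out : p.Prime).ne_zero
  have hpc : (p:ℂ) ≠ 0 := by exact_mod_cast hp0
  rw [sum_main, if_pos (dvd_mul_right _ _), gauss_eq]
  congr 1
  apply Finset.sum_congr rfl
  intro r _
  rw [MulChar.pow_apply' _ (by omega), qc_nat]
  congr 2
  push_cast
  field_simp
  ring

lemma mulShift_ne_one (p : ℕ) [Fact p.Prime] (c : ℤ) (hc : ¬ (p:ℤ) ∣ c) :
    (ZMod.stdAddChar (N := p)).mulShift (c : ZMod p) ≠ 1 := by
  apply ZMod.isPrimitive_stdAddChar p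
  rwa [Ne, ZMod.intCast_zmod_eq_zero_iff_dvd]

lemma qc_pow_odd (p : ℕ) [Fact p.Prime] (n : ℕ) (h : Odd n) : (qc p)^n = qc p := by
  obtain ⟨t, rfl⟩ := h
  rw [pow_add, pow_mul, (qc_quad p).sq_eq_one]; simp

lemma qc_pow_even (p : ℕ) [Fact p.Prime] (n : ℕ) (h : Even n) : (qc p)^n = 1 := by
  obtain ⟨t, rfl⟩ := h
  rw [← two_mul, pow_mul, (qc_quad p).sq_eq_one]; simp

lemma pref_even (p : ℕ) [Fact p.Prime] (n : ℕ) (h : Even n) :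
    ((1 - Complex.I) / 2 + (jacobiSym (-1) (p^n) : ℂ) * (1 + Complex.I) / 2) = 1 := by
  rw [jacobiSym.pow_right, ← jacobiSym.legendreSym.to_jacobiSym]
  have hne : ((-1 : ℤ) : ZMod p) ≠ 0 := by simp
  obtain ⟨t, rfl⟩ := h
  rw [← two_mul, pow_mul, legendreSym.sq_one p hne]
  push_cast; rw [one_pow]; ring

lemma pref_odd (p : ℕ) [Fact p.Prime] (n : ℕ) (h : Odd n) :
    jacobiSym (-1) (p^n) = legendreSym p (-1) := by
  rw [jacobiSym.pow_right, ← jacobiSym.legendreSym.to_jacobiSym]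
  have hne : ((-1 : ℤ) : ZMod p) ≠ 0 := by simp
  obtain ⟨t, rfl⟩ := h
  rw [pow_add, pow_mul, legendreSym.sq_one p hne]
  simp

/-- Lemma 2.3 (second part): explicit evaluation of `G_k(p^β)` for an odd
prime `p`, where `α = ord_p(k)`. -/
theorem stmt_3 (p : ℕ) (hp : p.Prime) (hpodd : Odd p) (k : ℤ) (hk : k ≠ 0)
    (β : ℕ) (hβ : 0 < β) :
    (β ≤ padicValInt p k → Odd β → Gk k (p ^ β) = 0) ∧
    (β ≤ padicValInt p k → Even β → Gk k (p ^ β) = (Nat.totient (p ^ β) : ℂ)) ∧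
    (β = padicValInt p k + 1 → Even β →
      Gk k (p ^ β) = -(p : ℂ) ^ (padicValInt p k)) ∧
    (β = padicValInt p k + 1 → Odd β →
      Gk k (p ^ β) =
        (jacobiSym (k / (p : ℤ) ^ (padicValInt p k)) p : ℂ)
          * (p : ℂ) ^ (padicValInt p k) * (Real.sqrt p : ℂ)) ∧
    (padicValInt p k + 2 ≤ β → Gk k (p ^ β) = 0) := by
  haveI : Fact p.Prime := ⟨hp⟩
  obtain ⟨b, rfl⟩ : ∃ b, β = b + 1 := ⟨β - 1, by omega⟩
  have hd : ∀ n, (p:ℤ)^n ∣ k ↔ n ≤ padicValInt p k := by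
    intro n
    rw [padicValInt_dvd_iff]; simp [hk]
  have hp0 : (p:ℤ) ≠ 0 := by exact_mod_cast hp.ne_zero
  have hone : b + 1 ≤ padicValInt p k → ∃ c : ℤ, k = p^b * c ∧ (c : ZMod p) = 0 := by
    intro h
    obtain ⟨c, hc⟩ := (hd (b+1)).2 h
    refine ⟨p * c, by rw [hc]; ring, by simp⟩
  have htwo : b + 1 = padicValInt p k + 1 → ∃ c : ℤ, k = p^b * c ∧ ¬ (p:ℤ) ∣ c := by
    intro h
    obtain ⟨c, hc⟩ := (hd b).2 (by omega)
    refine ⟨c, hc, ?_⟩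
    rintro ⟨d, rfl⟩
    have := (hd (b+1)).1 ⟨d, by rw [hc]; ring⟩
    omega
  have hshift0 : (ZMod.stdAddChar (N := p)).mulShift 0 = 1 := AddChar.mulShift_zero _
  refine ⟨?_, ?_, ?_, ?_, ?_⟩
  · intro h1 h2
    obtain ⟨c, rfl, hc⟩ := hone h1
    rw [Gk, sum_main2, hc, hshift0, qc_pow_odd p _ h2, gaussSum_one_right (qc_ne p hpodd)]
    simp
  · intro h1 h2
    obtain ⟨c, rfl, hc⟩ := hone h1
    rw [Gk, sum_main2, hc, hshift0, qc_pow_even p _ h2, pref_even p _ h2, gaussSum_one_one,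
      Nat.card_eq_fintype_card, ZMod.card_units, Nat.totient_prime_pow_succ hp]
    push_cast; ring
  · intro h1 h2
    obtain ⟨c, hk', hc⟩ := htwo h1
    have hb : padicValInt p k = b := by omega
    rw [hb, hk', Gk, sum_main2, qc_pow_even p _ h2, pref_even p _ h2,
      gaussSum_one_left (mulShift_ne_one p c hc)]
    ring
  · intro h1 h2
    obtain ⟨c, hk', hc⟩ := htwo h1
    have hb : padicValInt p k = b := by omega
    have hcz : (c : ZMod p) ≠ 0 := by rwa [Ne, ZMod.intCast_zmod_eq_zero_iff_dvd]
    have hs := gaussSum_mulShift_eq (qc p) ZMod.stdAddChar (Units.mk0 (c : ZMod p) hcz)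
    rw [Units.val_mk0, (qc_quad p).inv, qc_int] at hs
    rw [hb, hk', Gk, sum_main2, qc_pow_odd p _ h2, pref_odd p _ h2, hs,
      Int.mul_ediv_cancel_left _ (pow_ne_zero _ hp0), ← gauss_sum_sign p hpodd,
      ← jacobiSym.legendreSym.to_jacobiSym]
    ring
  · intro h1
    rw [Gk, sum_main, if_neg (by rw [hd]; omega)]
    simp
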